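/- Fix t > 0 and y, k ∈ ℝ. Let Φ(x) = ∫_{−∞}^x e^{−u²/2}/√(2π) du denote the standard normal cumulative distribution function, and for σ > 0 set d₊(σ) = (y − k + σ²t/2)/(σ√t), d₋(σ) = d₊(σ) − σ√t, and C(σ) = e^y Φ(d₊(σ)) − e^k Φ(d₋(σ)). Then for every real number u with max(e^y − e^k, 0) < u < e^y there exists a unique σ > 0 such that C(σ) = u. -/

import Mathlib

open MeasureTheory

/-- The standard normal cumulative distribution function. -/
noncomputable def stdNormalCdf (x : ℝ) : ℝ :=
  ∫ u in Set.Iio x, Real.exp (-u ^ 2 / 2) / Real.sqrt (2 * Real.pi)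

/-- `d₊` in the Black–Scholes formula (zero rates), as a function of volatility. -/
noncomputable def dPlus (t y k σ : ℝ) : ℝ :=
  (y - k + σ ^ 2 * t / 2) / (σ * Real.sqrt t)

/-- `d₋` in the Black–Scholes formula (zero rates), as a function of volatility. -/
noncomputable def dMinus (t y k σ : ℝ) : ℝ :=
  dPlus t y k σ - σ * Real.sqrt t

/-- The Black–Scholes call price (zero rates) with time to maturity `t`, log-spot `y`
and log-strike `k`, as a function of the volatility `σ`. -/
noncomputable def bsCall (t y k σ : ℝ) : ℝ :=
  Real.exp y * stdNormalCdf (dPlus t y k σ) - Real.exp k * stdNormalCdf (dMinus t y k σ)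

open Filter Topology ProbabilityTheory in
theorem stdNormalCdf_eq_cdf (x : ℝ) : stdNormalCdf x = cdf (gaussianReal 0 1) x := by
  rw [cdf_eq_real, Measure.real, gaussianReal_apply_eq_integral _ one_ne_zero,
    ENNReal.toReal_ofReal
      (setIntegral_nonneg measurableSet_Iic fun _ _ => gaussianPDFReal_nonneg _ _ _),
    integral_Iic_eq_integral_Iio, stdNormalCdf]
  congr 1 with u
  simp [gaussianPDFReal, div_eq_inv_mul]

open Filter Topology ProbabilityTheory in
theorem tendsto_stdNormalCdf_atBot : Tendsto stdNormalCdf atBot (𝓝 0) := by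
  simpa only [funext stdNormalCdf_eq_cdf] using tendsto_cdf_atBot (gaussianReal 0 1)

open Filter Topology ProbabilityTheory in
theorem tendsto_stdNormalCdf_atTop : Tendsto stdNormalCdf atTop (𝓝 1) := by
  simpa only [funext stdNormalCdf_eq_cdf] using tendsto_cdf_atTop (gaussianReal 0 1)

open ProbabilityTheory in
theorem integrable_stdNormal_density :
    Integrable fun u : ℝ => Real.exp (-u ^ 2 / 2) / Real.sqrt (2 * Real.pi) := by
  convert integrable_gaussianPDFReal 0 1 using 2 with u
  simp [gaussianPDFReal, div_eq_inv_mul]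

theorem hasDerivAt_stdNormalCdf (x : ℝ) :
    HasDerivAt stdNormalCdf (Real.exp (-x ^ 2 / 2) / Real.sqrt (2 * Real.pi)) x := by
  have hint := integrable_stdNormal_density
  have hcont : Continuous fun u : ℝ => Real.exp (-u ^ 2 / 2) / Real.sqrt (2 * Real.pi) := by
    fun_prop
  have heq : stdNormalCdf = fun b => stdNormalCdf 0 +
      ∫ u in (0 : ℝ)..b, Real.exp (-u ^ 2 / 2) / Real.sqrt (2 * Real.pi) := by
    funext b
    rw [← intervalIntegral.integral_Iic_sub_Iic hint.integrableOn hint.integrableOn]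
    simp [stdNormalCdf, integral_Iic_eq_integral_Iio]
  rw [heq]
  exact (hcont.integral_hasStrictDerivAt 0 x).hasDerivAt.const_add _

/-- The Black–Scholes call price as a function of the total volatility `s = σ√t`. -/
noncomputable def totalVolCall (y k s : ℝ) : ℝ :=
  Real.exp y * stdNormalCdf ((y - k) / s + s / 2) - Real.exp k * stdNormalCdf ((y - k) / s - s / 2)

theorem bsCall_eq_totalVolCall {t σ : ℝ} (ht : 0 < t) (hσ : 0 < σ) (y k : ℝ) :
    bsCall t y k σ = totalVolCall y k (σ * Real.sqrt t) := by
  have hst : 0 < Real.sqrt t := Real.sqrt_pos.2 ht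
  have hp : dPlus t y k σ = (y - k) / (σ * Real.sqrt t) + σ * Real.sqrt t / 2 := by
    rw [dPlus]
    field_simp
    rw [Real.sq_sqrt ht.le]
  have hm : dMinus t y k σ = (y - k) / (σ * Real.sqrt t) - σ * Real.sqrt t / 2 := by
    rw [dMinus, hp]
    ring
  rw [bsCall, hp, hm, totalVolCall]

theorem exp_mul_exp_dPlus_eq {s : ℝ} (hs : s ≠ 0) (y k : ℝ) :
    Real.exp y * Real.exp (-((y - k) / s + s / 2) ^ 2 / 2) =
      Real.exp k * Real.exp (-((y - k) / s - s / 2) ^ 2 / 2) := by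
  rw [← Real.exp_add, ← Real.exp_add]
  congr 1
  field_simp
  ring

theorem hasDerivAt_totalVolCall {s : ℝ} (hs : s ≠ 0) (y k : ℝ) :
    HasDerivAt (totalVolCall y k)
      (Real.exp k * (Real.exp (-((y - k) / s - s / 2) ^ 2 / 2) / Real.sqrt (2 * Real.pi))) s := by
  have hdiv : HasDerivAt (fun s : ℝ => (y - k) / s) (-(y - k) / s ^ 2) s := by
    simpa using (hasDerivAt_const s (y - k)).fun_div (hasDerivAt_id s) hs
  have hhalf : HasDerivAt (fun s : ℝ => s / 2) (1 / 2) s := (hasDerivAt_id s).div_const 2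
  have hp := ((hasDerivAt_stdNormalCdf _).comp s (hdiv.add hhalf)).const_mul (Real.exp y)
  have hm := ((hasDerivAt_stdNormalCdf _).comp s (hdiv.sub hhalf)).const_mul (Real.exp k)
  refine (hp.sub hm).congr_deriv ?_
  simp only [Pi.add_apply, Pi.sub_apply]
  linear_combination
    ((-(y - k) / s ^ 2 + 1 / 2) / Real.sqrt (2 * Real.pi)) * exp_mul_exp_dPlus_eq hs y k

theorem continuousOn_totalVolCall (y k : ℝ) : ContinuousOn (totalVolCall y k) (Set.Ioi 0) :=
  fun _ hs => (hasDerivAt_totalVolCall (ne_of_gt hs) y k).continuousAt.continuousWithinAt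

theorem strictMonoOn_totalVolCall (y k : ℝ) : StrictMonoOn (totalVolCall y k) (Set.Ioi 0) := by
  refine strictMonoOn_of_deriv_pos (convex_Ioi 0) (continuousOn_totalVolCall y k) fun s hs => ?_
  rw [interior_Ioi] at hs
  rw [(hasDerivAt_totalVolCall (ne_of_gt hs) y k).deriv]
  positivity

open Filter Topology in
theorem tendsto_totalVolCall_atTop (y k : ℝ) :
    Tendsto (totalVolCall y k) atTop (𝓝 (Real.exp y)) := by
  unfold totalVolCall
  have hdiv : Tendsto (fun s : ℝ => (y - k) / s) atTop (𝓝 0) :=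
    tendsto_const_nhds.div_atTop tendsto_id
  have hhalf : Tendsto (fun s : ℝ => s / 2) atTop atTop := tendsto_id.atTop_div_const two_pos
  have hp := tendsto_stdNormalCdf_atTop.comp (hdiv.add_atTop hhalf)
  have hm := tendsto_stdNormalCdf_atBot.comp
    (hdiv.add_atBot (tendsto_neg_atTop_atBot.comp hhalf))
  simpa [Function.comp_def, sub_eq_add_neg] using
    (hp.const_mul (Real.exp y)).sub (hm.const_mul (Real.exp k))

open Filter Topology in
theorem tendsto_totalVolCall_nhdsGT_zero (y k : ℝ) :
    Tendsto (totalVolCall y k) (𝓝[>] 0) (𝓝 (max (Real.exp y - Real.exp k) 0)) := by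
  unfold totalVolCall
  have hhalf : Tendsto (fun s : ℝ => s / 2) (𝓝[>] 0) (𝓝 0) := by
    have h : Continuous fun s : ℝ => s / 2 := by fun_prop
    simpa using (h.tendsto 0).mono_left nhdsWithin_le_nhds
  have hneg : Tendsto (fun s : ℝ => -(s / 2)) (𝓝[>] 0) (𝓝 0) := by simpa using hhalf.neg
  rcases lt_trichotomy y k with h | rfl | h
  · have hdiv : Tendsto (fun s : ℝ => (y - k) / s) (𝓝[>] 0) atBot :=
      tendsto_inv_nhdsGT_zero.const_mul_atTop_of_neg (sub_neg.2 h)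
    have hp := tendsto_stdNormalCdf_atBot.comp (hdiv.atBot_add hhalf)
    have hm := tendsto_stdNormalCdf_atBot.comp (hdiv.atBot_add hneg)
    rw [max_eq_right (sub_nonpos.2 (Real.exp_le_exp.2 h.le))]
    simpa [Function.comp_def, sub_eq_add_neg] using
      (hp.const_mul (Real.exp y)).sub (hm.const_mul (Real.exp k))
  · have hc := (hasDerivAt_stdNormalCdf 0).continuousAt.tendsto
    simpa [Function.comp_def] using
      ((hc.comp hhalf).const_mul (Real.exp y)).sub ((hc.comp hneg).const_mul (Real.exp y))
  · have hdiv : Tendsto (fun s : ℝ => (y - k) / s) (𝓝[>] 0) atTop :=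
      tendsto_inv_nhdsGT_zero.const_mul_atTop (sub_pos.2 h)
    have hp := tendsto_stdNormalCdf_atTop.comp (hdiv.atTop_add hhalf)
    have hm := tendsto_stdNormalCdf_atTop.comp (hdiv.atTop_add hneg)
    rw [max_eq_left (sub_nonneg.2 (Real.exp_le_exp.2 h.le))]
    simpa [Function.comp_def, sub_eq_add_neg] using
      (hp.const_mul (Real.exp y)).sub (hm.const_mul (Real.exp k))

open Filter Topology in
theorem exists_totalVolCall_eq {y k u : ℝ} (hlow : max (Real.exp y - Real.exp k) 0 < u)
    (hhigh : u < Real.exp y) : ∃ s, 0 < s ∧ totalVolCall y k s = u := by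
  obtain ⟨a, hau, ha⟩ := (((tendsto_totalVolCall_nhdsGT_zero y k).eventually_lt_const hlow).and
    self_mem_nhdsWithin).exists
  obtain ⟨b, hub, hb⟩ := (((tendsto_totalVolCall_atTop y k).eventually_const_lt hhigh).and
    (eventually_gt_atTop 0)).exists
  exact isPreconnected_Ioi.intermediate_value ha hb (continuousOn_totalVolCall y k)
    ⟨hau.le, hub.le⟩

/-- Existence and uniqueness of implied volatility: for every option price `u` with
`(e^y − e^k)⁺ < u < e^y` there exists a unique `σ > 0` such that `C(σ) = u`. -/
theorem impliedVol_exists_unique (t y k : ℝ) (ht : 0 < t) (u : ℝ)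
    (hlow : max (Real.exp y - Real.exp k) 0 < u) (hhigh : u < Real.exp y) :
    ∃! σ : ℝ, 0 < σ ∧ bsCall t y k σ = u := by
  have hst : 0 < Real.sqrt t := Real.sqrt_pos.2 ht
  obtain ⟨s, hs, rfl⟩ := exists_totalVolCall_eq hlow hhigh
  refine ⟨s / Real.sqrt t, ⟨div_pos hs hst, ?_⟩, ?_⟩
  · rw [bsCall_eq_totalVolCall ht (div_pos hs hst), div_mul_cancel₀ _ hst.ne']
  · rintro σ ⟨hσ, h⟩
    rw [bsCall_eq_totalVolCall ht hσ] at h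
    rw [eq_div_iff hst.ne']
    exact (strictMonoOn_totalVolCall y k).injOn (mul_pos hσ hst) hs h
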